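/- The following two statements are equivalent. (RK) For all positive-definite ternary quadratic forms f, g over ℝ such that c·f has some irrational coefficient for every c ∈ ℝ×: if q_ℤ(f) = q_ℤ(g) and f is not GL₃(ℤ)-equivalent to g, then there exist c, d ∈ ℝ such that, as unordered pairs up to GL₃(ℤ)-equivalence, {f, g} equals { c(x₁²−x₁x₂+x₂²)+dx₃², c(x₁²+3x₂²)+dx₃² } or { c(x₁²−x₁x₂+x₂²)+d(x₁+x₂+3x₃)², c(x₁²+3x₂²)+d(x₁+3x₃)² }. (*) For all pairs (A₁,B₁), (A₂,B₂) of ternary quadratic forms over ℚ satisfying: (a) Aᵢ, Bᵢ linearly independent over ℚ; (b) some rational combination c·Aᵢ + d·Bᵢ is positive definite; (c) q_ℤ(A₁,B₁) = q_ℤ(A₂,B₂); either (A₁,B₁) = (w,1)·(A₂,B₂) for some w ∈ GL₃(ℤ), or there exist w₁, w₂ ∈ GL₃(ℤ) and v ∈ GL₂(ℚ) such that the unordered pair {(A₁,B₁), (A₂,B₂)} equals { (w₁,v)·(x₁²−x₁x₂+x₂², x₃²), (w₂,v)·(x₁²+3x₂², x₃²) } or { (w₁,v)·(x₁²−x₁x₂+x₂²,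 (x₁+x₂+3x₃)²), (w₂,v)·(x₁²+3x₂², (x₁+3x₃)²) }. -/

import Mathlib

open Matrix

/-! Real side -/

/-- Representations over ℤ of a real ternary quadratic form. -/
def repZR (f : Matrix (Fin 3) (Fin 3) ℝ) : Set ℝ :=
  {r : ℝ | ∃ x : Fin 3 → ℤ, x ≠ 0 ∧
    (fun i => (x i : ℝ)) ⬝ᵥ (f *ᵥ fun i => (x i : ℝ)) = r}

/-- `GL₃(ℤ)`-equivalence of real ternary quadratic forms: `f(xw) = g(x)`. -/
def equivZR (f g : Matrix (Fin 3) (Fin 3) ℝ) : Prop :=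
  ∃ w : Matrix (Fin 3) (Fin 3) ℤ, IsUnit w.det ∧
    (w.map ((↑) : ℤ → ℝ)) * f * (w.map ((↑) : ℤ → ℝ))ᵀ = g

/-- Gram matrix of `x₁² − x₁x₂ + x₂²` over ℝ. -/
noncomputable def hexR : Matrix (Fin 3) (Fin 3) ℝ := !![1, -1/2, 0; -1/2, 1, 0; 0, 0, 0]

/-- Gram matrix of `x₁² + 3x₂²` over ℝ. -/
noncomputable def eisR : Matrix (Fin 3) (Fin 3) ℝ := !![1, 0, 0; 0, 3, 0; 0, 0, 0]

/-- Gram matrix of `x₃²` over ℝ. -/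
noncomputable def zR : Matrix (Fin 3) (Fin 3) ℝ := !![0, 0, 0; 0, 0, 0; 0, 0, 1]

/-- Gram matrix of `(x₁ + x₂ + 3x₃)²` over ℝ. -/
noncomputable def rhR : Matrix (Fin 3) (Fin 3) ℝ := !![1, 1, 3; 1, 1, 3; 3, 3, 9]

/-- Gram matrix of `(x₁ + 3x₃)²` over ℝ. -/
noncomputable def rhR' : Matrix (Fin 3) (Fin 3) ℝ := !![1, 0, 3; 0, 0, 0; 3, 0, 9]

/-- The (restricted) Kaplansky conjecture for forms that are not rational up to scaling. -/
def RKStatement : Prop :=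
  ∀ f g : Matrix (Fin 3) (Fin 3) ℝ, f.IsSymm → g.IsSymm → f.PosDef → g.PosDef →
    (∀ c : ℝ, c ≠ 0 → ∃ i j : Fin 3, ∀ q : ℚ, c * f i j ≠ (q : ℝ)) →
    repZR f = repZR g → ¬ equivZR f g →
    ∃ c d : ℝ,
      (equivZR f (c • hexR + d • zR) ∧ equivZR g (c • eisR + d • zR)) ∨
      (equivZR f (c • eisR + d • zR) ∧ equivZR g (c • hexR + d • zR)) ∨
      (equivZR f (c • hexR + d • rhR) ∧ equivZR g (c • eisR + d • rhR')) ∨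
      (equivZR f (c • eisR + d • rhR') ∧ equivZR g (c • hexR + d • rhR))

/-! Rational side -/

/-- Simultaneous representations over ℤ of a pair of rational ternary quadratic forms. -/
def simRepZ (A B : Matrix (Fin 3) (Fin 3) ℚ) : Set (ℚ × ℚ) :=
  {p : ℚ × ℚ | ∃ x : Fin 3 → ℤ, x ≠ 0 ∧
    (fun i => (x i : ℚ)) ⬝ᵥ (A *ᵥ fun i => (x i : ℚ)) = p.1 ∧
    (fun i => (x i : ℚ)) ⬝ᵥ (B *ᵥ fun i => (x i : ℚ)) = p.2}

/-- The action of `GL₃ × GL₂` on pairs of ternary quadratic forms: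
`(w, v)·(A,B) = (v₀₀·A(xw) + v₀₁·B(xw), v₁₀·A(xw) + v₁₁·B(xw))`. -/
def pairAct (w : Matrix (Fin 3) (Fin 3) ℚ) (v : Matrix (Fin 2) (Fin 2) ℚ)
    (A B : Matrix (Fin 3) (Fin 3) ℚ) :
    Matrix (Fin 3) (Fin 3) ℚ × Matrix (Fin 3) (Fin 3) ℚ :=
  (v 0 0 • (w * A * wᵀ) + v 0 1 • (w * B * wᵀ),
   v 1 0 • (w * A * wᵀ) + v 1 1 • (w * B * wᵀ))

/-- Gram matrix of `x₁² − x₁x₂ + x₂²`. -/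
def formHex : Matrix (Fin 3) (Fin 3) ℚ := !![1, -1/2, 0; -1/2, 1, 0; 0, 0, 0]

/-- Gram matrix of `x₁² + 3x₂²`. -/
def formE : Matrix (Fin 3) (Fin 3) ℚ := !![1, 0, 0; 0, 3, 0; 0, 0, 0]

/-- Gram matrix of `x₃²`. -/
def formZ : Matrix (Fin 3) (Fin 3) ℚ := !![0, 0, 0; 0, 0, 0; 0, 0, 1]

/-- Gram matrix of `(x₁ + x₂ + 3x₃)²`. -/
def formR : Matrix (Fin 3) (Fin 3) ℚ := !![1, 1, 3; 1, 1, 3; 3, 3, 9]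

/-- Gram matrix of `(x₁ + 3x₃)²`. -/
def formR' : Matrix (Fin 3) (Fin 3) ℚ := !![1, 0, 3; 0, 0, 0; 3, 0, 9]

/-- Statement (*) on pairs of rational ternary quadratic forms. -/
def StarStatement : Prop :=
  ∀ A₁ B₁ A₂ B₂ : Matrix (Fin 3) (Fin 3) ℚ,
    A₁.IsSymm → B₁.IsSymm → A₂.IsSymm → B₂.IsSymm →
    -- (a) linear independence over ℚ
    (∀ a b : ℚ, a • A₁ + b • B₁ = 0 → a = 0 ∧ b = 0) →
    (∀ a b : ℚ, a • A₂ + b • B₂ = 0 → a = 0 ∧ b = 0) →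
    -- (b) some rational combination is positive definite
    (∃ c d : ℚ, ((c • A₁ + d • B₁).map ((↑) : ℚ → ℝ)).PosDef) →
    (∃ c d : ℚ, ((c • A₂ + d • B₂).map ((↑) : ℚ → ℝ)).PosDef) →
    -- (c) identical simultaneous representations over ℤ
    simRepZ A₁ B₁ = simRepZ A₂ B₂ →
    (∃ w : Matrix (Fin 3) (Fin 3) ℤ, IsUnit w.det ∧
        (A₁, B₁) = pairAct (w.map ((↑) : ℤ → ℚ)) 1 A₂ B₂) ∨
    ∃ w₁ w₂ : Matrix (Fin 3) (Fin 3) ℤ, IsUnit w₁.det ∧ IsUnit w₂.det ∧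
      ∃ v : Matrix (Fin 2) (Fin 2) ℚ, IsUnit v.det ∧
        (({(A₁, B₁), (A₂, B₂)} :
            Set (Matrix (Fin 3) (Fin 3) ℚ × Matrix (Fin 3) (Fin 3) ℚ))
          = {pairAct (w₁.map ((↑) : ℤ → ℚ)) v formHex formZ,
             pairAct (w₂.map ((↑) : ℤ → ℚ)) v formE formZ} ∨
         ({(A₁, B₁), (A₂, B₂)} :
            Set (Matrix (Fin 3) (Fin 3) ℚ × Matrix (Fin 3) (Fin 3) ℚ))
          = {pairAct (w₁.map ((↑) : ℤ → ℚ)) v formHex formR,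
             pairAct (w₂.map ((↑) : ℤ → ℚ)) v formE formR'})

namespace TernaryPair

/-! ### Positive definite matrices -/

section PosDef

variable {n : Type*} [Fintype n]

theorem abs_dotProduct_mulVec_le (M : Matrix n n ℝ) {ε : ℝ} (hM : ∀ i j, |M i j| ≤ ε)
    (x : n → ℝ) : |x ⬝ᵥ (M *ᵥ x)| ≤ ε * Fintype.card n * (x ⬝ᵥ x) := by
  have h1 : |x ⬝ᵥ (M *ᵥ x)| ≤ ∑ i, ∑ j, ε * ((x i ^ 2 + x j ^ 2) / 2) := by
    simp only [dotProduct, mulVec, Finset.mul_sum]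
    refine (Finset.abs_sum_le_sum_abs _ _).trans (Finset.sum_le_sum fun i _ => ?_)
    refine (Finset.abs_sum_le_sum_abs _ _).trans (Finset.sum_le_sum fun j _ => ?_)
    have h2 : |x i| * |x j| ≤ (x i ^ 2 + x j ^ 2) / 2 := by
      nlinarith [sq_nonneg (|x i| - |x j|), sq_abs (x i), sq_abs (x j)]
    calc |x i * (M i j * x j)| = |M i j| * (|x i| * |x j|) := by
          rw [abs_mul, abs_mul]; ring
      _ ≤ ε * ((x i ^ 2 + x j ^ 2) / 2) :=
          mul_le_mul (hM i j) h2 (by positivity) ((abs_nonneg _).trans (hM i j))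
  refine h1.trans_eq ?_
  simp only [← Finset.mul_sum, ← Finset.sum_div, Finset.sum_add_distrib, Finset.sum_const,
    Finset.card_univ, nsmul_eq_mul, dotProduct]
  simp only [← pow_two]
  ring

theorem exists_pos_mul_dotProduct_le {P : Matrix n n ℝ} (hP : P.PosDef) :
    ∃ ε : ℝ, 0 < ε ∧ ∀ x : n → ℝ, ε * (x ⬝ᵥ x) ≤ x ⬝ᵥ (P *ᵥ x) := by
  classical
  have hpos : ∀ x : n → ℝ, x ≠ 0 → 0 < x ⬝ᵥ (P *ᵥ x) := fun x hx => by
    simpa using hP.dotProduct_mulVec_pos hx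
  rcases isEmpty_or_nonempty n with h | h
  · exact ⟨1, one_pos, fun x => by simp [dotProduct]⟩
  have hcont : Continuous fun x : n → ℝ => x ⬝ᵥ (P *ᵥ x) := by
    simp only [dotProduct, mulVec]; fun_prop
  obtain ⟨y, hy, hmin⟩ := (isCompact_sphere (0 : n → ℝ) 1).exists_isMinOn
    (NormedSpace.sphere_nonempty.2 zero_le_one) hcont.continuousOn
  have hy0 : y ≠ 0 := by
    rintro rfl; simp at hy
  set m := y ⬝ᵥ (P *ᵥ y) with hm
  have hmpos : 0 < m := hpos y hy0
  have hcard : (0 : ℝ) < Fintype.card n := by exact_mod_cast Fintype.card_pos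
  refine ⟨m / Fintype.card n, by positivity, fun x => ?_⟩
  by_cases hx : x = 0
  · simp [hx]
  have hn : 0 < ‖x‖ := norm_pos_iff.2 hx
  have hs : (‖x‖⁻¹ • x) ∈ Metric.sphere (0 : n → ℝ) 1 := by
    simp [norm_smul, hn.ne']
  have h1 : m ≤ ‖x‖⁻¹ * (‖x‖⁻¹ * (x ⬝ᵥ (P *ᵥ x))) := by
    simpa [mulVec_smul] using hmin hs
  have h2 : m * ‖x‖ ^ 2 ≤ x ⬝ᵥ (P *ᵥ x) := by
    calc m * ‖x‖ ^ 2 ≤ ‖x‖⁻¹ * (‖x‖⁻¹ * (x ⬝ᵥ (P *ᵥ x))) * ‖x‖ ^ 2 := by gcongr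
      _ = _ := by field_simp
  have h3 : x ⬝ᵥ x ≤ Fintype.card n * ‖x‖ ^ 2 := by
    calc x ⬝ᵥ x ≤ ∑ _i : n, ‖x‖ ^ 2 := by
          refine Finset.sum_le_sum fun i _ => ?_
          rw [← pow_two, ← sq_abs]
          exact pow_le_pow_left₀ (abs_nonneg _) (norm_le_pi_norm x i) 2
      _ = _ := by simp
  calc m / Fintype.card n * (x ⬝ᵥ x) ≤ m / Fintype.card n * (Fintype.card n * ‖x‖ ^ 2) := by gcongr
    _ = m * ‖x‖ ^ 2 := by field_simp
    _ ≤ _ := h2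

theorem exists_forall_near_posDef {P : Matrix n n ℝ} (hP : P.PosDef) :
    ∃ ε : ℝ, 0 < ε ∧ ∀ Q : Matrix n n ℝ, Q.IsSymm → (∀ i j, |Q i j - P i j| < ε) →
      Q.PosDef := by
  obtain ⟨δ, hδ, h⟩ := exists_pos_mul_dotProduct_le hP
  refine ⟨δ / (Fintype.card n + 1), by positivity, fun Q hQ hPQ => ?_⟩
  refine .of_dotProduct_mulVec_pos ((conjTranspose_eq_transpose_of_trivial Q).trans hQ) fun x hx => ?_
  have hxx : 0 < x ⬝ᵥ x := by
    simpa using (dotProduct_star_self_pos_iff (v := x)).2 hx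
  have h1 := abs_dotProduct_mulVec_le (Q - P) (ε := δ / (Fintype.card n + 1))
    (fun i j => (hPQ i j).le) x
  have h2 : x ⬝ᵥ ((Q - P) *ᵥ x) = x ⬝ᵥ (Q *ᵥ x) - x ⬝ᵥ (P *ᵥ x) := by
    rw [sub_mulVec, dotProduct_sub]
  have h3 : δ / (Fintype.card n + 1) * Fintype.card n * (x ⬝ᵥ x) < δ * (x ⬝ᵥ x) := by
    refine mul_lt_mul_of_pos_right ?_ hxx
    rw [div_mul_eq_mul_div, div_lt_iff₀ (by positivity)]
    linarith
  have h4 := h x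
  rw [h2] at h1
  have := (abs_le.1 h1).1
  simp only [star_trivial]
  linarith

/-- The integral congruences between two positive definite forms are finite in number. -/
theorem finite_setOf_conj_eq [DecidableEq n] (P : Matrix n n ℝ) {P' : Matrix n n ℝ}
    (hP' : P'.PosDef) :
    {w : Matrix n n ℤ | w.map ((↑) : ℤ → ℝ) * P' * (w.map ((↑) : ℤ → ℝ))ᵀ = P}.Finite := by
  obtain ⟨ε, hε, h⟩ := exists_pos_mul_dotProduct_le hP'
  let N : n → ℤ := fun i => ⌈P i i / ε⌉
  refine Set.Finite.subset
    (Set.finite_Icc (fun i _ => - N i : n → n → ℤ) (fun i _ => N i : n → n → ℤ))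
    fun (w : Matrix n n ℤ) hw => ?_
  have key : ∀ i j, |w i j| ≤ N i := fun i j => by
    have h1 : (fun k => (w i k : ℝ)) ⬝ᵥ (P' *ᵥ fun k => (w i k : ℝ)) = P i i := by
      have hw' : w.map ((↑) : ℤ → ℝ) * P' * (w.map ((↑) : ℤ → ℝ))ᵀ = P := hw
      rw [← hw', dotProduct_mulVec]
      rfl
    have h2 := h fun k => (w i k : ℝ)
    have h3 : ((w i j : ℝ)) ^ 2 ≤ (fun k => (w i k : ℝ)) ⬝ᵥ (fun k => (w i k : ℝ)) := by
      simp only [dotProduct, ← pow_two]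
      exact Finset.single_le_sum (f := fun k => (w i k : ℝ) ^ 2) (fun _ _ => sq_nonneg _)
        (Finset.mem_univ j)
    have h4 : ((w i j : ℝ)) ^ 2 ≤ P i i / ε := by
      rw [le_div_iff₀ hε]
      nlinarith
    have h5 : w i j ^ 2 ≤ N i := by
      exact_mod_cast h4.trans (Int.le_ceil _)
    have h6 : |w i j| ≤ w i j ^ 2 := by
      rw [← sq_abs]; exact Int.le_self_sq _
    exact h6.trans h5
  exact ⟨fun i j => (abs_le.1 (key i j)).1, fun i j => (abs_le.1 (key i j)).2⟩

theorem exists_int_smul (y : n → ℚ) (hy : y ≠ 0) :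
    ∃ (d : ℤ) (x : n → ℤ), d ≠ 0 ∧ x ≠ 0 ∧ ∀ i, (x i : ℚ) = d * y i := by
  obtain ⟨d, hd⟩ := IsLocalization.exist_integer_multiples_of_finite (nonZeroDivisors ℤ) y
  choose x hx using hd
  have hd0 : (d : ℤ) ≠ 0 := nonZeroDivisors.coe_ne_zero d
  have hx' : ∀ i, (x i : ℚ) = (d : ℤ) * y i := fun i => by simpa using hx i
  refine ⟨d, x, hd0, ?_, hx'⟩
  rintro rfl
  refine hy (funext fun i => ?_)
  have := hx' i
  simp only [Pi.zero_apply, Int.cast_zero, zero_eq_mul, Int.cast_eq_zero] at this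
  exact this.resolve_left hd0

theorem cast_dotProduct_mulVec (Q : Matrix n n ℚ) (x : n → ℚ) :
    ((x ⬝ᵥ (Q *ᵥ x) : ℚ) : ℝ) =
      (fun i => (x i : ℝ)) ⬝ᵥ (Q.map ((↑) : ℚ → ℝ) *ᵥ fun i => (x i : ℝ)) := by
  simp [dotProduct, mulVec]

/-- A rational form which is positive on nonzero integral vectors is positive definite. -/
theorem posDef_of_int_pos [DecidableEq n] {Q : Matrix n n ℚ} (hQ : Q.IsSymm)
    (h : ∀ x : n → ℤ, x ≠ 0 → 0 < (fun i => (x i : ℚ)) ⬝ᵥ (Q *ᵥ fun i => (x i : ℚ))) :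
    (Q.map ((↑) : ℚ → ℝ)).PosDef := by
  have hrat : ∀ y : n → ℚ, y ≠ 0 → 0 < y ⬝ᵥ (Q *ᵥ y) := fun y hy => by
    obtain ⟨d, x, hd, hx, hxy⟩ := exists_int_smul y hy
    have h1 := h x hx
    have h2 : (fun i => (x i : ℚ)) = (d : ℚ) • y := funext hxy
    rw [h2, mulVec_smul, dotProduct_smul, smul_dotProduct] at h1
    have h3 : (d : ℚ) • (d : ℚ) • (y ⬝ᵥ (Q *ᵥ y)) = (d : ℚ) ^ 2 * (y ⬝ᵥ (Q *ᵥ y)) := by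
      simp only [smul_eq_mul]; ring
    rw [h3] at h1
    exact pos_of_mul_pos_right h1 (sq_nonneg _)
  have hherm : (Q.map ((↑) : ℚ → ℝ)).IsHermitian := by
    ext i j
    simp [hQ.apply i j]
  have hcont : Continuous fun x : n → ℝ => x ⬝ᵥ (Q.map ((↑) : ℚ → ℝ) *ᵥ x) := by
    simp only [dotProduct, mulVec]; fun_prop
  have hdense : DenseRange (Pi.map fun (_ : n) (q : ℚ) => (q : ℝ)) :=
    DenseRange.piMap fun _ => Rat.denseRange_cast
  have hsemi : (Q.map ((↑) : ℚ → ℝ)).PosSemidef := by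
    refine .of_dotProduct_mulVec_nonneg hherm fun x => ?_
    simp only [star_trivial]
    refine hdense.induction_on (p := fun x => 0 ≤ x ⬝ᵥ (Q.map ((↑) : ℚ → ℝ) *ᵥ x)) x
      (isClosed_le continuous_const hcont) fun y => ?_
    have := cast_dotProduct_mulVec Q y
    change 0 ≤ (fun i => (y i : ℝ)) ⬝ᵥ (Q.map ((↑) : ℚ → ℝ) *ᵥ fun i => (y i : ℝ))
    rw [← this]
    by_cases hy : y = 0
    · simp [hy]
    · exact_mod_cast (hrat y hy).le
  rw [hsemi.posDef_iff_det_ne_zero]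
  intro hdet
  have hdetQ : Q.det = 0 := by
    have h1 := RingHom.map_det (Rat.castHom ℝ) Q
    have h2 : (Rat.castHom ℝ).mapMatrix Q = Q.map ((↑) : ℚ → ℝ) := rfl
    rw [h2, hdet] at h1
    simpa using h1
  obtain ⟨v, hv, hQv⟩ := exists_mulVec_eq_zero_iff.2 hdetQ
  have := hrat v hv
  simp [hQv] at this

theorem eventually_posDef [DecidableEq n] {X : Type*} [TopologicalSpace X] {F : X → Matrix n n ℝ}
    (hF : ∀ i j, Continuous fun x => F x i j) (hs : ∀ x, (F x).IsSymm) {a : X}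
    (ha : (F a).PosDef) : ∀ᶠ x in nhds a, (F x).PosDef := by
  obtain ⟨ε, hε, h⟩ := exists_forall_near_posDef ha
  have key : ∀ᶠ x in nhds a, ∀ i j, |F x i j - F a i j| < ε :=
    Filter.eventually_all.2 fun i => Filter.eventually_all.2 fun j => by
      simpa [Real.dist_eq] using
        Metric.tendsto_nhds.1 ((hF i j).tendsto a) ε hε
  exact key.mono fun x hx => h _ (hs x) hx

end PosDef

/-! ### Integral change of variables -/

section Conj

variable {R : Type*} [CommRing R]

/-- The form `x ↦ M(xw)`, for an integral matrix `w`. -/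
def conj (w : Matrix (Fin 3) (Fin 3) ℤ) (M : Matrix (Fin 3) (Fin 3) R) :
    Matrix (Fin 3) (Fin 3) R :=
  w.map ((↑) : ℤ → R) * M * (w.map ((↑) : ℤ → R))ᵀ

theorem conj_add (w : Matrix (Fin 3) (Fin 3) ℤ) (M N : Matrix (Fin 3) (Fin 3) R) :
    conj w (M + N) = conj w M + conj w N := by
  simp [conj, Matrix.mul_add, Matrix.add_mul]

theorem conj_smul (w : Matrix (Fin 3) (Fin 3) ℤ) (c : R) (M : Matrix (Fin 3) (Fin 3) R) :
    conj w (c • M) = c • conj w M := by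
  simp [conj]

theorem conj_conj (w w' : Matrix (Fin 3) (Fin 3) ℤ) (M : Matrix (Fin 3) (Fin 3) R) :
    conj w' (conj w M) = conj (w' * w) M := by
  have h : (w' * w).map ((↑) : ℤ → R) = w'.map (↑) * w.map (↑) :=
    Matrix.map_mul (f := Int.castRingHom R)
  simp only [conj, h, transpose_mul, Matrix.mul_assoc]

theorem conj_one (M : Matrix (Fin 3) (Fin 3) R) : conj 1 M = M := by
  have h : (1 : Matrix (Fin 3) (Fin 3) ℤ).map ((↑) : ℤ → R) = 1 :=
    Matrix.map_one _ Int.cast_zero Int.cast_one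
  simp [conj, h]

theorem conj_inv_conj {w : Matrix (Fin 3) (Fin 3) ℤ} (hw : IsUnit w.det)
    (M : Matrix (Fin 3) (Fin 3) R) : conj w⁻¹ (conj w M) = M := by
  rw [conj_conj, nonsing_inv_mul _ hw, conj_one]

theorem isUnit_det_inv {w : Matrix (Fin 3) (Fin 3) ℤ} (hw : IsUnit w.det) :
    IsUnit (w⁻¹).det := isUnit_nonsing_inv_det w hw

theorem det_conj {w : Matrix (Fin 3) (Fin 3) ℤ} (hw : IsUnit w.det)
    (M : Matrix (Fin 3) (Fin 3) R) : (conj w M).det = M.det := by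
  have h : (w.map ((↑) : ℤ → R)).det = (w.det : R) :=
    ((Int.castRingHom R).map_det w).symm
  rw [conj, det_mul, det_mul, det_transpose, h, mul_comm, ← mul_assoc]
  rcases Int.isUnit_iff.1 hw with h1 | h1 <;> simp [h1]

theorem conj_vecMulVec (w : Matrix (Fin 3) (Fin 3) ℤ) (r : Fin 3 → R) :
    conj w (vecMulVec r r) = vecMulVec (w.map (↑) *ᵥ r) (w.map (↑) *ᵥ r) := by
  rw [conj, mul_vecMulVec, vecMulVec_mul, vecMul_transpose]

theorem conj_map_ratCast (w : Matrix (Fin 3) (Fin 3) ℤ) (M : Matrix (Fin 3) (Fin 3) ℚ) :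
    conj w (M.map ((↑) : ℚ → ℝ)) = (conj w M).map ((↑) : ℚ → ℝ) := by
  ext i j
  simp [conj, Matrix.mul_apply]

theorem conj_map_dual (ψ : Module.Dual ℚ ℝ) (w : Matrix (Fin 3) (Fin 3) ℤ)
    (M : Matrix (Fin 3) (Fin 3) ℝ) : (conj w M).map ψ = conj w (M.map ψ) := by
  ext i j
  simp only [conj, Matrix.mul_apply, map_apply, transpose_apply, map_sum, Finset.sum_mul]
  refine Finset.sum_congr rfl fun k _ => Finset.sum_congr rfl fun l _ => ?_
  have h : (w i l : ℝ) * M l k * (w j k : ℝ) = ((w i l : ℚ) * w j k) • M l k := by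
    rw [Rat.smul_def]; push_cast; ring
  rw [h, map_smul, smul_eq_mul]
  ring

theorem equivZR_symm {f g : Matrix (Fin 3) (Fin 3) ℝ} (h : equivZR f g) : equivZR g f := by
  obtain ⟨w, hw, rfl⟩ := h
  exact ⟨w⁻¹, isUnit_det_inv hw, conj_inv_conj hw f⟩

theorem pairAct_map (w : Matrix (Fin 3) (Fin 3) ℤ) (v : Matrix (Fin 2) (Fin 2) ℚ)
    (A B : Matrix (Fin 3) (Fin 3) ℚ) :
    pairAct (w.map (↑)) v A B =
      (conj w (v 0 0 • A + v 0 1 • B), conj w (v 1 0 • A + v 1 1 • B)) := by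
  simp only [conj_add, conj_smul]
  rfl

end Conj

/-! ### The exceptional pairs -/

/-- The pairs of forms `(H, Z)`, `(H', Z')` appearing in the exceptional cases, in either order. -/
def IsModel (H Z H' Z' : Matrix (Fin 3) (Fin 3) ℚ) : Prop :=
  (H = formHex ∧ Z = formZ ∧ H' = formE ∧ Z' = formZ) ∨
  (H = formE ∧ Z = formZ ∧ H' = formHex ∧ Z' = formZ) ∨
  (H = formHex ∧ Z = formR ∧ H' = formE ∧ Z' = formR') ∨
  (H = formE ∧ Z = formR' ∧ H' = formHex ∧ Z' = formR)

/-- The pairs `(A₁, B₁)` and `(A₂, B₂)` come from a model by a common rational change of basis of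
the pencils and separate integral changes of variables. -/
def IsExceptional (A₁ B₁ A₂ B₂ : Matrix (Fin 3) (Fin 3) ℚ) : Prop :=
  ∃ w₁ w₂ : Matrix (Fin 3) (Fin 3) ℤ, IsUnit w₁.det ∧ IsUnit w₂.det ∧
    ∃ v : Matrix (Fin 2) (Fin 2) ℚ, IsUnit v.det ∧ ∃ H Z H' Z', IsModel H Z H' Z' ∧
      (A₁, B₁) = pairAct (w₁.map ((↑) : ℤ → ℚ)) v H Z ∧
      (A₂, B₂) = pairAct (w₂.map ((↑) : ℤ → ℚ)) v H' Z'

section Model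

variable {H Z H' Z' : Matrix (Fin 3) (Fin 3) ℚ}

theorem IsModel.det_eq_zero (h : IsModel H Z H' Z') {a b : ℚ}
    (hd : (a • H + b • Z).det = (a • H' + b • Z').det) : (a • H + b • Z).det = 0 := by
  rcases h with h | h | h | h <;> obtain ⟨rfl, rfl, rfl, rfl⟩ := h <;>
    simp only [det_fin_three, formHex, formE, formZ, formR, formR', Matrix.add_apply,
      Matrix.smul_apply, of_apply, cons_val, smul_eq_mul] at hd ⊢ <;>
    first | linear_combination (1 / 3 : ℚ) * hd | linear_combination (-1 / 3 : ℚ) * hd |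
      linear_combination (4 / 3 : ℚ) * hd

theorem IsModel.exists_eq_vecMulVec (h : IsModel H Z H' Z') : ∃ r, Z = vecMulVec r r := by
  rcases h with h | h | h | h <;> obtain ⟨rfl, rfl, rfl, rfl⟩ := h
  · exact ⟨![0, 0, 1], by ext i j; fin_cases i <;> fin_cases j <;> simp [formZ, vecMulVec]⟩
  · exact ⟨![0, 0, 1], by ext i j; fin_cases i <;> fin_cases j <;> simp [formZ, vecMulVec]⟩
  · exact ⟨![1, 1, 3], by
      ext i j; fin_cases i <;> fin_cases j <;> norm_num [formR, vecMulVec]⟩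
  · exact ⟨![1, 0, 3], by
      ext i j; fin_cases i <;> fin_cases j <;> norm_num [formR', vecMulVec]⟩

theorem IsModel.apply (h : IsModel H Z H' Z') : H 1 1 ≠ 0 ∧ H 2 2 = 0 ∧ Z 2 2 ≠ 0 := by
  rcases h with h | h | h | h <;> obtain ⟨rfl, rfl, rfl, rfl⟩ := h <;>
    simp [formHex, formE, formZ, formR, formR']

theorem map_formHex : formHex.map ((↑) : ℚ → ℝ) = hexR := by
  ext i j; fin_cases i <;> fin_cases j <;> simp [formHex, hexR]

theorem map_formE : formE.map ((↑) : ℚ → ℝ) = eisR := by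
  ext i j; fin_cases i <;> fin_cases j <;> simp [formE, eisR]

theorem map_formZ : formZ.map ((↑) : ℚ → ℝ) = zR := by
  ext i j; fin_cases i <;> fin_cases j <;> simp [formZ, zR]

theorem map_formR : formR.map ((↑) : ℚ → ℝ) = rhR := by
  ext i j; fin_cases i <;> fin_cases j <;> simp [formR, rhR]

theorem map_formR' : formR'.map ((↑) : ℚ → ℝ) = rhR' := by
  ext i j; fin_cases i <;> fin_cases j <;> simp [formR', rhR']

theorem exists_isModel_iff (f g : Matrix (Fin 3) (Fin 3) ℝ) (c d : ℝ) :
    (∃ H Z H' Z', IsModel H Z H' Z' ∧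
      equivZR f (c • H.map ((↑) : ℚ → ℝ) + d • Z.map ((↑) : ℚ → ℝ)) ∧
      equivZR g (c • H'.map ((↑) : ℚ → ℝ) + d • Z'.map ((↑) : ℚ → ℝ))) ↔
    (equivZR f (c • hexR + d • zR) ∧ equivZR g (c • eisR + d • zR)) ∨
      (equivZR f (c • eisR + d • zR) ∧ equivZR g (c • hexR + d • zR)) ∨
      (equivZR f (c • hexR + d • rhR) ∧ equivZR g (c • eisR + d • rhR')) ∨
      (equivZR f (c • eisR + d • rhR') ∧ equivZR g (c • hexR + d • rhR)) := by
  simp only [← map_formHex, ← map_formE, ← map_formZ, ← map_formR, ← map_formR']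
  constructor
  · rintro ⟨H, Z, H', Z', hm, h⟩
    rcases hm with h1 | h1 | h1 | h1 <;> obtain ⟨rfl, rfl, rfl, rfl⟩ := h1
    exacts [.inl h, .inr (.inl h), .inr (.inr (.inl h)), .inr (.inr (.inr h))]
  · rintro (h | h | h | h)
    exacts [⟨_, _, _, _, .inl ⟨rfl, rfl, rfl, rfl⟩, h⟩,
      ⟨_, _, _, _, .inr (.inl ⟨rfl, rfl, rfl, rfl⟩), h⟩,
      ⟨_, _, _, _, .inr (.inr (.inl ⟨rfl, rfl, rfl, rfl⟩)), h⟩,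
      ⟨_, _, _, _, .inr (.inr (.inr ⟨rfl, rfl, rfl, rfl⟩)), h⟩]

theorem isExceptional_iff (A₁ B₁ A₂ B₂ : Matrix (Fin 3) (Fin 3) ℚ) :
    IsExceptional A₁ B₁ A₂ B₂ ↔
    ∃ w₁ w₂ : Matrix (Fin 3) (Fin 3) ℤ, IsUnit w₁.det ∧ IsUnit w₂.det ∧
      ∃ v : Matrix (Fin 2) (Fin 2) ℚ, IsUnit v.det ∧
        (({(A₁, B₁), (A₂, B₂)} :
            Set (Matrix (Fin 3) (Fin 3) ℚ × Matrix (Fin 3) (Fin 3) ℚ))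
          = {pairAct (w₁.map ((↑) : ℤ → ℚ)) v formHex formZ,
             pairAct (w₂.map ((↑) : ℤ → ℚ)) v formE formZ} ∨
         ({(A₁, B₁), (A₂, B₂)} :
            Set (Matrix (Fin 3) (Fin 3) ℚ × Matrix (Fin 3) (Fin 3) ℚ))
          = {pairAct (w₁.map ((↑) : ℤ → ℚ)) v formHex formR,
             pairAct (w₂.map ((↑) : ℤ → ℚ)) v formE formR'}) := by
  simp only [Set.pair_eq_pair_iff]
  constructor
  · rintro ⟨w₁, w₂, h₁, h₂, v, hv, H, Z, H', Z', hm, h⟩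
    rcases hm with h1 | h1 | h1 | h1 <;> obtain ⟨rfl, rfl, rfl, rfl⟩ := h1
    exacts [⟨w₁, w₂, h₁, h₂, v, hv, .inl (.inl h)⟩, ⟨w₂, w₁, h₂, h₁, v, hv, .inl (.inr h)⟩,
      ⟨w₁, w₂, h₁, h₂, v, hv, .inr (.inl h)⟩, ⟨w₂, w₁, h₂, h₁, v, hv, .inr (.inr h)⟩]
  · rintro ⟨w₁, w₂, h₁, h₂, v, hv, (h | h) | (h | h)⟩
    exacts [⟨w₁, w₂, h₁, h₂, v, hv, _, _, _, _, .inl ⟨rfl, rfl, rfl, rfl⟩, h⟩,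
      ⟨w₂, w₁, h₂, h₁, v, hv, _, _, _, _, .inr (.inl ⟨rfl, rfl, rfl, rfl⟩), h⟩,
      ⟨w₁, w₂, h₁, h₂, v, hv, _, _, _, _, .inr (.inr (.inl ⟨rfl, rfl, rfl, rfl⟩)), h⟩,
      ⟨w₂, w₁, h₂, h₁, v, hv, _, _, _, _, .inr (.inr (.inr ⟨rfl, rfl, rfl, rfl⟩)), h⟩]

theorem IsExceptional.det_ne {A₁ B₁ A₂ B₂ : Matrix (Fin 3) (Fin 3) ℚ}
    (h : IsExceptional A₁ B₁ A₂ B₂) (hA : A₁.det ≠ 0) : A₁.det ≠ A₂.det := by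
  obtain ⟨w₁, w₂, h₁, h₂, v, -, H, Z, H', Z', hm, e₁, e₂⟩ := h
  rw [pairAct_map, Prod.mk.injEq] at e₁ e₂
  rw [e₁.1, det_conj h₁] at hA ⊢
  rw [e₂.1, det_conj h₂]
  exact fun hd => hA (hm.det_eq_zero hd)

theorem IsExceptional.exists_eq_add_vecMulVec {A₁ B₁ A₂ B₂ : Matrix (Fin 3) (Fin 3) ℚ}
    (h : IsExceptional A₁ B₁ A₂ B₂) (hA : A₁.det ≠ 0) :
    ∃ (s t : ℚ) (r : Fin 3 → ℚ), B₁ = s • A₁ + t • vecMulVec r r := by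
  obtain ⟨w₁, w₂, h₁, -, v, -, H, Z, H', Z', hm, e₁, -⟩ := h
  rw [pairAct_map, Prod.mk.injEq] at e₁
  obtain ⟨r, rfl⟩ := hm.exists_eq_vecMulVec
  have hv : v 0 0 ≠ 0 := by
    intro hv
    rw [e₁.1, det_conj h₁, hv, zero_smul, zero_add] at hA
    refine hA ?_
    rw [det_smul, det_vecMulVec, mul_zero]
  refine ⟨v 1 0 / v 0 0, v 1 1 - v 1 0 / v 0 0 * v 0 1, w₁.map (↑) *ᵥ r, ?_⟩
  rw [← conj_vecMulVec, e₁.1, e₁.2]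
  simp only [conj_add, conj_smul, smul_add, smul_smul, div_mul_cancel₀ _ hv, sub_smul]
  abel

end Model

/-! ### Values of forms on integral vectors -/

section Values

theorem eq_zero_of_forall_int {M : Matrix (Fin 3) (Fin 3) ℚ} (hM : M.IsSymm)
    (h : ∀ x : Fin 3 → ℤ, x ≠ 0 → (fun i => (x i : ℚ)) ⬝ᵥ (M *ᵥ fun i => (x i : ℚ)) = 0) :
    M = 0 := by
  have s01 := hM.apply 0 1
  have s02 := hM.apply 0 2
  have s12 := hM.apply 1 2
  have e0 := h ![1, 0, 0] (fun h => by simpa using congrFun h 0)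
  have e1 := h ![0, 1, 0] (fun h => by simpa using congrFun h 1)
  have e2 := h ![0, 0, 1] (fun h => by simpa using congrFun h 2)
  have e01 := h ![1, 1, 0] (fun h => by simpa using congrFun h 0)
  have e02 := h ![1, 0, 1] (fun h => by simpa using congrFun h 0)
  have e12 := h ![0, 1, 1] (fun h => by simpa using congrFun h 1)
  simp [dotProduct, mulVec, Fin.sum_univ_three] at e0 e1 e2 e01 e02 e12
  ext i j
  fin_cases i <;> fin_cases j <;> simp <;> linarith

theorem dotProduct_combination {R : Type*} [CommRing R] (a b : R)
    (A B : Matrix (Fin 3) (Fin 3) R) (x : Fin 3 → R) :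
    x ⬝ᵥ ((a • A + b • B) *ᵥ x) = a * (x ⬝ᵥ (A *ᵥ x)) + b * (x ⬝ᵥ (B *ᵥ x)) := by
  simp [add_mulVec, smul_mulVec]

theorem isSymm_combination {R : Type*} [CommRing R] (a b : R)
    {A B : Matrix (Fin 3) (Fin 3) R} (hA : A.IsSymm) (hB : B.IsSymm) :
    (a • A + b • B).IsSymm := (hA.smul a).add (hB.smul b)

theorem cast_dotProduct_intCast_mulVec (Q : Matrix (Fin 3) (Fin 3) ℚ) (x : Fin 3 → ℤ) :
    (((fun i => (x i : ℚ)) ⬝ᵥ (Q *ᵥ fun i => (x i : ℚ)) : ℚ) : ℝ) =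
      (fun i => (x i : ℝ)) ⬝ᵥ (Q.map ((↑) : ℚ → ℝ) *ᵥ fun i => (x i : ℝ)) := by
  simpa using cast_dotProduct_mulVec Q fun i => (x i : ℚ)

theorem posDef_of_simRepZ_eq {A₁ B₁ A₂ B₂ : Matrix (Fin 3) (Fin 3) ℚ}
    (hA₂ : A₂.IsSymm) (hB₂ : B₂.IsSymm) (h : simRepZ A₁ B₁ = simRepZ A₂ B₂) {c d : ℚ}
    (hpos : ((c • A₁ + d • B₁).map ((↑) : ℚ → ℝ)).PosDef) :
    ((c • A₂ + d • B₂).map ((↑) : ℚ → ℝ)).PosDef := by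
  refine posDef_of_int_pos (isSymm_combination c d hA₂ hB₂) fun x hx => ?_
  have hmem : ((fun i => (x i : ℚ)) ⬝ᵥ (A₂ *ᵥ fun i => (x i : ℚ)),
      (fun i => (x i : ℚ)) ⬝ᵥ (B₂ *ᵥ fun i => (x i : ℚ))) ∈ simRepZ A₁ B₁ :=
    h ▸ ⟨x, hx, rfl, rfl⟩
  obtain ⟨y, hy, h1, h2⟩ := hmem
  simp only at h1 h2
  rw [dotProduct_combination, ← h1, ← h2, ← dotProduct_combination]
  have hy' : (fun i => (y i : ℝ)) ≠ 0 := fun h0 => hy (funext fun i => by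
    simpa using congrFun h0 i)
  have := hpos.dotProduct_mulVec_pos hy'
  rw [star_trivial, ← cast_dotProduct_intCast_mulVec] at this
  exact_mod_cast this

theorem repZR_combination (A B : Matrix (Fin 3) (Fin 3) ℚ) (a b : ℝ) :
    repZR (a • A.map ((↑) : ℚ → ℝ) + b • B.map ((↑) : ℚ → ℝ)) =
      (fun p : ℚ × ℚ => a * p.1 + b * p.2) '' simRepZ A B := by
  ext r
  constructor
  · rintro ⟨x, hx, rfl⟩
    refine ⟨((fun i => (x i : ℚ)) ⬝ᵥ (A *ᵥ fun i => (x i : ℚ)),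
      (fun i => (x i : ℚ)) ⬝ᵥ (B *ᵥ fun i => (x i : ℚ))), ⟨x, hx, rfl, rfl⟩, ?_⟩
    simp only [dotProduct_combination, cast_dotProduct_intCast_mulVec]
  · rintro ⟨⟨p, q⟩, ⟨x, hx, rfl, rfl⟩, rfl⟩
    refine ⟨x, hx, ?_⟩
    simp only [dotProduct_combination, cast_dotProduct_intCast_mulVec]

theorem dotProduct_map_dual_mulVec (φ : Module.Dual ℚ ℝ) (f : Matrix (Fin 3) (Fin 3) ℝ)
    (x : Fin 3 → ℤ) :
    (fun i => (x i : ℚ)) ⬝ᵥ (f.map φ *ᵥ fun i => (x i : ℚ)) =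
      φ ((fun i => (x i : ℝ)) ⬝ᵥ (f *ᵥ fun i => (x i : ℝ))) := by
  simp only [dotProduct, mulVec, Finset.mul_sum, map_sum, map_apply]
  refine Finset.sum_congr rfl fun i _ => Finset.sum_congr rfl fun j _ => ?_
  have h : (x i : ℝ) * (f i j * x j) = ((x i : ℚ) * x j) • f i j := by
    rw [Rat.smul_def]; push_cast; ring
  rw [h, map_smul, smul_eq_mul]
  ring

theorem simRepZ_map_dual (φ ψ : Module.Dual ℚ ℝ) (f : Matrix (Fin 3) (Fin 3) ℝ) :
    simRepZ (f.map φ) (f.map ψ) = (fun r => (φ r, ψ r)) '' repZR f := by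
  ext ⟨p, q⟩
  constructor
  · rintro ⟨x, hx, rfl, rfl⟩
    exact ⟨_, ⟨x, hx, rfl⟩, by simp only [dotProduct_map_dual_mulVec]⟩
  · rintro ⟨_, ⟨x, hx, rfl⟩, h⟩
    rw [Prod.mk.injEq] at h
    exact ⟨x, hx, by rw [dotProduct_map_dual_mulVec, h.1], by rw [dotProduct_map_dual_mulVec, h.2]⟩

end Values

/-! ### From real forms to pairs of rational forms -/

section RationalOfReal

theorem exists_independent_near (c d : ℚ) (h : c ≠ 0 ∨ d ≠ 0) {p : ℝ → ℝ → Prop}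
    (hp : ∀ᶠ t in nhds (0 : ℝ), p (c - t * d) (d + t * c)) :
    ∃ a b : ℝ, p a b ∧ ∀ r s : ℚ, (r : ℝ) * a + s * b = 0 → r = 0 ∧ s = 0 := by
  have hlim : Filter.Tendsto (fun n : ℕ => √2 * (1 / ((n : ℝ) + 1))) Filter.atTop (nhds 0) := by
    simpa using tendsto_one_div_add_atTop_nhds_zero_nat.const_mul √2
  obtain ⟨n, hn⟩ := (hlim.eventually hp).exists
  refine ⟨_, _, hn, fun r s hrs => ?_⟩
  have hirr : Irrational (√2 * (1 / ((n : ℝ) + 1))) := by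
    have h1 : (1 / ((n : ℚ) + 1)) ≠ 0 := by positivity
    have := irrational_sqrt_two.mul_ratCast h1
    push_cast at this
    exact this
  set t := √2 * (1 / ((n : ℝ) + 1))
  have h1 : s * c - r * d = 0 := by
    by_contra h0
    refine hirr ⟨-(r * c + s * d) / (s * c - r * d), ?_⟩
    have h0' : (s * c - r * d : ℝ) ≠ 0 := by exact_mod_cast h0
    push_cast
    rw [div_eq_iff h0']
    linear_combination -hrs
  have h1' : (s * c - r * d : ℝ) = 0 := by exact_mod_cast h1
  have h2 : r * c + s * d = 0 := by
    have : (r * c + s * d : ℝ) = 0 := by linear_combination hrs - t * h1'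
    exact_mod_cast this
  have hcd : c ^ 2 + d ^ 2 ≠ 0 := by
    rcases h with h | h <;> positivity
  constructor
  · refine (mul_eq_zero.1 (?_ : r * (c ^ 2 + d ^ 2) = 0)).resolve_right hcd
    linear_combination c * h2 - d * h1
  · refine (mul_eq_zero.1 (?_ : s * (c ^ 2 + d ^ 2) = 0)).resolve_right hcd
    linear_combination d * h2 + c * h1

theorem eq_of_combination_eq {a b : ℝ}
    (hab : ∀ r s : ℚ, (r : ℝ) * a + s * b = 0 → r = 0 ∧ s = 0)
    {M N M' N' : Matrix (Fin 3) (Fin 3) ℚ}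
    (h : a • M.map ((↑) : ℚ → ℝ) + b • N.map ((↑) : ℚ → ℝ) =
      a • M'.map ((↑) : ℚ → ℝ) + b • N'.map ((↑) : ℚ → ℝ)) : M = M' ∧ N = N' := by
  have key : ∀ i j, M i j - M' i j = 0 ∧ N i j - N' i j = 0 := fun i j => by
    refine hab _ _ ?_
    have := congrFun (congrFun h i) j
    simp only [Matrix.add_apply, Matrix.smul_apply, map_apply, smul_eq_mul] at this
    push_cast
    linear_combination this
  exact ⟨ext fun i j => sub_eq_zero.1 (key i j).1, ext fun i j => sub_eq_zero.1 (key i j).2⟩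

theorem exists_irrational_apply {A B : Matrix (Fin 3) (Fin 3) ℚ}
    (hAB : ∀ a b : ℚ, a • A + b • B = 0 → a = 0 ∧ b = 0) {a b : ℝ}
    (hab : ∀ r s : ℚ, (r : ℝ) * a + s * b = 0 → r = 0 ∧ s = 0) {k : ℝ} (hk : k ≠ 0) :
    ∃ i j : Fin 3, ∀ q : ℚ,
      k * (a • A.map ((↑) : ℚ → ℝ) + b • B.map ((↑) : ℚ → ℝ)) i j ≠ q := by
  by_contra! hcon
  choose q hq using hcon
  have hψ : ∀ ψ : Module.Dual ℚ ℝ, ψ 1 = 0 → ψ (k * a) = 0 ∧ ψ (k * b) = 0 := fun ψ h1 => by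
    refine hAB _ _ (ext fun i j => ?_)
    have h2 : A i j • (k * a) + B i j • (k * b) = q i j • (1 : ℝ) := by
      have := hq i j
      simp only [Matrix.add_apply, Matrix.smul_apply, map_apply, smul_eq_mul] at this
      simp only [Rat.smul_def]
      linear_combination this
    have h3 := congrArg ψ h2
    simp only [map_add, map_smul, h1, smul_eq_mul, mul_zero] at h3
    simp only [Matrix.add_apply, Matrix.smul_apply, smul_eq_mul, Matrix.zero_apply]
    linear_combination h3
  have hspan : ∀ x : ℝ, (∀ ψ : Module.Dual ℚ ℝ, ψ 1 = 0 → ψ x = 0) → ∃ r : ℚ, (r : ℝ) = x := by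
    intro x hx
    by_contra hr
    have hx' : x ∉ Submodule.span ℚ {(1 : ℝ)} := fun hmem => by
      obtain ⟨r, hr'⟩ := Submodule.mem_span_singleton.1 hmem
      exact hr ⟨r, by simpa [Rat.smul_def] using hr'⟩
    obtain ⟨ψ, h1, h2⟩ := Submodule.exists_le_ker_of_notMem hx'
    exact h1 (hx ψ (h2 (Submodule.mem_span_singleton_self _)))
  obtain ⟨r, hr⟩ := hspan _ fun ψ h => (hψ ψ h).1
  obtain ⟨s, hs⟩ := hspan _ fun ψ h => (hψ ψ h).2
  obtain ⟨-, hr0⟩ := hab s (-r) (by push_cast; rw [hr, hs]; ring)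
  rw [neg_eq_zero] at hr0
  rw [hr0, Rat.cast_zero, zero_eq_mul] at hr
  have := (hab 1 0 (by simp [hr.resolve_left hk])).1
  exact one_ne_zero this

theorem isExceptional_of_equivZR {A₁ B₁ A₂ B₂ H Z H' Z' : Matrix (Fin 3) (Fin 3) ℚ}
    (hAB : ∀ a b : ℚ, a • A₁ + b • B₁ = 0 → a = 0 ∧ b = 0) {a b : ℝ}
    (hab : ∀ r s : ℚ, (r : ℝ) * a + s * b = 0 → r = 0 ∧ s = 0)
    (hm : IsModel H Z H' Z') {c d : ℝ}
    (h₁ : equivZR (a • A₁.map ((↑) : ℚ → ℝ) + b • B₁.map ((↑) : ℚ → ℝ))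
      (c • H.map ((↑) : ℚ → ℝ) + d • Z.map ((↑) : ℚ → ℝ)))
    (h₂ : equivZR (a • A₂.map ((↑) : ℚ → ℝ) + b • B₂.map ((↑) : ℚ → ℝ))
      (c • H'.map ((↑) : ℚ → ℝ) + d • Z'.map ((↑) : ℚ → ℝ))) :
    IsExceptional A₁ B₁ A₂ B₂ := by
  obtain ⟨w₁, u₁, h₁⟩ := h₁
  obtain ⟨w₂, u₂, h₂⟩ := h₂
  change conj w₁ _ = _ at h₁
  change conj w₂ _ = _ at h₂
  simp only [conj_add, conj_smul, conj_map_ratCast] at h₁ h₂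
  obtain ⟨p, q, r, s, hc, hd⟩ : ∃ p q r s : ℚ, c = a * p + b * q ∧ d = a * r + b * s := by
    obtain ⟨n1, n2, n3⟩ := hm.apply
    have n1' : (H 1 1 : ℝ) ≠ 0 := by exact_mod_cast n1
    have n3' : (Z 2 2 : ℝ) ≠ 0 := by exact_mod_cast n3
    have e1 := congrFun (congrFun h₁ 1) 1
    have e2 := congrFun (congrFun h₁ 2) 2
    simp only [Matrix.add_apply, Matrix.smul_apply, map_apply, smul_eq_mul, n2, Rat.cast_zero,
      mul_zero, zero_add] at e1 e2
    have hd : d = a * ((conj w₁ A₁ 2 2 / Z 2 2 : ℚ) : ℝ) +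
        b * ((conj w₁ B₁ 2 2 / Z 2 2 : ℚ) : ℝ) := by
      push_cast
      field_simp
      linear_combination -e2
    refine ⟨(conj w₁ A₁ 1 1 - Z 1 1 * (conj w₁ A₁ 2 2 / Z 2 2)) / H 1 1,
      (conj w₁ B₁ 1 1 - Z 1 1 * (conj w₁ B₁ 2 2 / Z 2 2)) / H 1 1, _, _, ?_, hd⟩
    rw [hd] at e1
    push_cast at e1 ⊢
    field_simp at e1 ⊢
    linear_combination -e1
  have hsplit : ∀ M N : Matrix (Fin 3) (Fin 3) ℚ,
      c • M.map ((↑) : ℚ → ℝ) + d • N.map ((↑) : ℚ → ℝ) =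
        a • (p • M + r • N).map ((↑) : ℚ → ℝ) + b • (q • M + s • N).map ((↑) : ℚ → ℝ) := by
    intro M N
    ext i j
    simp only [hc, hd, Matrix.add_apply, Matrix.smul_apply, map_apply, smul_eq_mul]
    push_cast
    ring
  rw [hsplit] at h₁ h₂
  obtain ⟨hA₁, hB₁⟩ := eq_of_combination_eq hab h₁
  obtain ⟨hA₂, hB₂⟩ := eq_of_combination_eq hab h₂
  have hA₁' : A₁ = conj w₁⁻¹ (p • H + r • Z) := by rw [← hA₁, conj_inv_conj u₁]
  have hB₁' : B₁ = conj w₁⁻¹ (q • H + s • Z) := by rw [← hB₁, conj_inv_conj u₁]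
  refine ⟨w₁⁻¹, w₂⁻¹, isUnit_det_inv u₁, isUnit_det_inv u₂, !![p, r; q, s], ?_, H, Z, H', Z', hm,
    ?_, ?_⟩
  · rw [isUnit_iff_ne_zero, det_fin_two_of]
    intro hdet
    have k1 : s • A₁ + (-r) • B₁ = 0 := by
      have : s * p = r * q := by linear_combination hdet
      rw [hA₁', hB₁']
      simp only [← conj_smul, smul_add, smul_smul, neg_smul, this, mul_comm]
      simp [conj]
    have k2 : q • A₁ + (-p) • B₁ = 0 := by
      have : q * r = p * s := by linear_combination -hdet
      rw [hA₁', hB₁']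
      simp only [← conj_smul, smul_add, smul_smul, neg_smul, this, mul_comm]
      simp [conj]
    obtain ⟨-, hr⟩ := hAB _ _ k1
    obtain ⟨-, hp⟩ := hAB _ _ k2
    rw [neg_eq_zero] at hr hp
    rw [hp, hr] at hA₁'
    have := (hAB 1 0 (by simp [hA₁', conj])).1
    exact one_ne_zero this
  · rw [pairAct_map, hA₁', hB₁']
    simp
  · rw [pairAct_map, ← conj_inv_conj u₂ A₂, ← conj_inv_conj u₂ B₂, hA₂, hB₂]
    simp

theorem starStatement_of_rkStatement (hRK : RKStatement) : StarStatement := by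
  intro A₁ B₁ A₂ B₂ sA₁ sB₁ sA₂ sB₂ hi₁ hi₂ hpos _ hrep
  obtain ⟨c, d, hpos₁⟩ := hpos
  have hpos₂ := posDef_of_simRepZ_eq sA₂ sB₂ hrep hpos₁
  rw [← isExceptional_iff]
  have hcd : c ≠ 0 ∨ d ≠ 0 := by
    by_contra! h
    have := hpos₁.diag_pos (i := 0)
    simp [h.1, h.2] at this
  have symm_map : ∀ {A B : Matrix (Fin 3) (Fin 3) ℚ}, A.IsSymm → B.IsSymm → ∀ a b : ℝ,
      (a • A.map ((↑) : ℚ → ℝ) + b • B.map ((↑) : ℚ → ℝ)).IsSymm :=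
    fun hA hB a b => isSymm_combination a b (hA.map _) (hB.map _)
  have near : ∀ {A B : Matrix (Fin 3) (Fin 3) ℚ}, A.IsSymm → B.IsSymm →
      ((c • A + d • B).map ((↑) : ℚ → ℝ)).PosDef →
      ∀ᶠ t in nhds (0 : ℝ), (((c : ℝ) - t * d) • A.map ((↑) : ℚ → ℝ) +
        ((d : ℝ) + t * c) • B.map ((↑) : ℚ → ℝ)).PosDef := by
    intro A B hA hB h
    refine eventually_posDef
      (F := fun t : ℝ => ((c : ℝ) - t * d) • A.map ((↑) : ℚ → ℝ) +
        ((d : ℝ) + t * c) • B.map ((↑) : ℚ → ℝ)) (a := (0 : ℝ))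
      (fun i j => ?_) (fun t => symm_map hA hB _ _) ?_
    · simp only [Matrix.add_apply, Matrix.smul_apply, map_apply, smul_eq_mul]
      fun_prop
    · convert h using 1
      ext i j
      simp
  obtain ⟨a, b, ⟨hf, hg⟩, hab⟩ := exists_independent_near c d hcd
    (p := fun a b => (a • A₁.map ((↑) : ℚ → ℝ) + b • B₁.map ((↑) : ℚ → ℝ)).PosDef ∧
      (a • A₂.map ((↑) : ℚ → ℝ) + b • B₂.map ((↑) : ℚ → ℝ)).PosDef)
    ((near sA₁ sB₁ hpos₁).and (near sA₂ sB₂ hpos₂))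
  by_cases heq : equivZR (a • A₂.map ((↑) : ℚ → ℝ) + b • B₂.map ((↑) : ℚ → ℝ))
      (a • A₁.map ((↑) : ℚ → ℝ) + b • B₁.map ((↑) : ℚ → ℝ))
  · obtain ⟨w, hw, h⟩ := heq
    change conj w _ = _ at h
    simp only [conj_add, conj_smul, conj_map_ratCast] at h
    obtain ⟨h1, h2⟩ := eq_of_combination_eq hab h
    refine .inl ⟨w, hw, ?_⟩
    rw [pairAct_map, ← h1, ← h2]
    simp
  · obtain ⟨C, D, h⟩ := hRK _ _ (symm_map sA₁ sB₁ a b) (symm_map sA₂ sB₂ a b) hf hg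
      (fun k hk => exists_irrational_apply hi₁ hab hk)
      (by rw [repZR_combination, repZR_combination, hrep]) (fun h => heq (equivZR_symm h))
    obtain ⟨H, Z, H', Z', hm, h₁, h₂⟩ := (exists_isModel_iff _ _ C D).2 h
    exact .inr (isExceptional_of_equivZR hi₁ hab hm h₁ h₂)

end RationalOfReal

/-! ### Rank one forms in a space of ternary forms -/

section RankOne

theorem exists_ne_zero_orthogonal (u v : Fin 3 → ℚ) :
    ∃ x : Fin 3 → ℚ, x ≠ 0 ∧ u ⬝ᵥ x = 0 ∧ v ⬝ᵥ x = 0 := by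
  obtain ⟨x, hx, h⟩ := exists_mulVec_eq_zero_iff.2
    (det_eq_zero_of_row_eq_zero (A := Matrix.of ![u, v, 0]) 2 fun _ => rfl)
  exact ⟨x, hx, congrFun h 0, congrFun h 1⟩

theorem exists_eq_smul_of_orthogonal {u v : Fin 3 → ℚ}
    (h : ∀ x, u ⬝ᵥ x = 0 → v ⬝ᵥ x = 0) : ∃ c : ℚ, v = c • u := by
  by_cases hu : u = 0
  · refine ⟨0, ?_⟩
    have := h v (by simp [hu])
    simpa using dotProduct_self_eq_zero.1 this
  · have huu : u ⬝ᵥ u ≠ 0 := fun h0 => hu (dotProduct_self_eq_zero.1 h0)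
    refine ⟨(u ⬝ᵥ v) / (u ⬝ᵥ u), sub_eq_zero.1 (dotProduct_self_eq_zero.1 ?_)⟩
    have h1 : u ⬝ᵥ (v - ((u ⬝ᵥ v) / (u ⬝ᵥ u)) • u) = 0 := by
      rw [dotProduct_sub, dotProduct_smul, smul_eq_mul, div_mul_cancel₀ _ huu, sub_self]
    rw [sub_dotProduct, smul_dotProduct, h1, h _ h1, smul_zero, sub_zero]

theorem dotProduct_vecMulVec_mulVec (u x : Fin 3 → ℚ) :
    x ⬝ᵥ (vecMulVec u u *ᵥ x) = (u ⬝ᵥ x) ^ 2 := by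
  rw [vecMulVec_mulVec]
  simp only [dotProduct_smul, MulOpposite.smul_eq_mul_unop, MulOpposite.unop_op]
  rw [dotProduct_comm x u, pow_two]

/-- If modulo a positive definite form `P` every form of a linear space `W` is a multiple of the
square of a linear form, then `W` is at most two-dimensional. -/
theorem mem_span_pair_of_rank_one {P : Matrix (Fin 3) (Fin 3) ℚ}
    (hP : ∀ x : Fin 3 → ℚ, x ≠ 0 → 0 < x ⬝ᵥ (P *ᵥ x))
    {W : Submodule ℚ (Matrix (Fin 3) (Fin 3) ℚ)} (hPW : P ∈ W)
    (hW : ∀ Q ∈ W, Q ∉ Submodule.span ℚ {P} →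
      ∃ (s t : ℚ) (r : Fin 3 → ℚ), Q = s • P + t • vecMulVec r r)
    {Q S : Matrix (Fin 3) (Fin 3) ℚ} (hQ : Q ∈ W) (hQP : Q ∉ Submodule.span ℚ {P}) (hS : S ∈ W) :
    ∃ a b : ℚ, S = a • P + b • Q := by
  simp only [Submodule.mem_span_singleton, not_exists] at hW hQP
  by_contra! hSPQ
  obtain ⟨s, t, l, hl⟩ := hW Q hQ hQP
  obtain ⟨s', t', m, hm⟩ := hW S hS fun a ha => hSPQ a 0 (by simp [ha])
  have ht : t ≠ 0 := by
    rintro rfl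
    exact hQP s (by simp [hl])
  have ht' : t' ≠ 0 := by
    rintro rfl
    exact hSPQ s' 0 (by simp [hm])
  have hlQ : vecMulVec l l = t⁻¹ • (Q - s • P) := by
    rw [hl, add_sub_cancel_left, smul_smul, inv_mul_cancel₀ ht, one_smul]
  have hmS : vecMulVec m m = t'⁻¹ • (S - s' • P) := by
    rw [hm, add_sub_cancel_left, smul_smul, inv_mul_cancel₀ ht', one_smul]
  have hindep : ∀ a b : ℚ, vecMulVec m m ≠ a • P + b • vecMulVec l l := by
    intro a b hab
    refine hSPQ (s' + t' * a - t' * b * t⁻¹ * s) (t' * b * t⁻¹) ?_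
    rw [hm, hab, hlQ]
    module
  have hd : vecMulVec l l - vecMulVec m m ∈ W := by
    rw [hlQ, hmS]
    exact W.sub_mem (W.smul_mem _ (W.sub_mem hQ (W.smul_mem _ hPW)))
      (W.smul_mem _ (W.sub_mem hS (W.smul_mem _ hPW)))
  obtain ⟨α, β, k, hk⟩ := hW _ hd fun a ha => hindep (-a) 1 (by
    rw [neg_smul, ha]; module)
  have hval : ∀ x : Fin 3 → ℚ,
      (l ⬝ᵥ x) ^ 2 - (m ⬝ᵥ x) ^ 2 = α * (x ⬝ᵥ (P *ᵥ x)) + β * (k ⬝ᵥ x) ^ 2 := by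
    intro x
    have := congrArg (fun M => x ⬝ᵥ (M *ᵥ x)) hk
    simpa only [sub_mulVec, dotProduct_sub, dotProduct_combination,
      dotProduct_vecMulVec_mulVec] using this
  have hα : α = 0 := by
    refine le_antisymm ?_ ?_
    · obtain ⟨x, hx, h1, h2⟩ := exists_ne_zero_orthogonal l k
      have := hval x
      rw [h1, h2] at this
      nlinarith [hP x hx, sq_nonneg (m ⬝ᵥ x)]
    · obtain ⟨x, hx, h1, h2⟩ := exists_ne_zero_orthogonal m k
      have := hval x
      rw [h1, h2] at this
      nlinarith [hP x hx, sq_nonneg (l ⬝ᵥ x)]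
  simp only [hα, zero_mul, zero_add] at hval
  rcases le_total 0 β with hβ | hβ
  · obtain ⟨c, rfl⟩ := exists_eq_smul_of_orthogonal (u := l) (v := m) fun x hx => by
      have := hval x
      rw [hx] at this
      have h1 : 0 ≤ β * (k ⬝ᵥ x) ^ 2 := by positivity
      exact pow_eq_zero_iff two_ne_zero |>.1 (le_antisymm (by linarith) (sq_nonneg _))
    exact hindep 0 (c * c) (by
      rw [smul_vecMulVec, vecMulVec_smul]
      simp [smul_smul])
  · obtain ⟨c, rfl⟩ := exists_eq_smul_of_orthogonal (u := m) (v := l) fun x hx => by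
      have := hval x
      rw [hx] at this
      have h1 : β * (k ⬝ᵥ x) ^ 2 ≤ 0 := mul_nonpos_of_nonpos_of_nonneg hβ (sq_nonneg _)
      exact pow_eq_zero_iff two_ne_zero |>.1 (le_antisymm (by linarith) (sq_nonneg _))
    have hc : c ≠ 0 := by
      rintro rfl
      exact hQP s (by simp [hl])
    exact hindep 0 (c⁻¹ * c⁻¹) (by
      rw [smul_vecMulVec, vecMulVec_smul]
      simp only [zero_smul, zero_add, smul_smul]
      rw [show c⁻¹ * c⁻¹ * (c * c) = 1 by field_simp, one_smul])

end RankOne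

/-! ### From pairs of rational forms to real forms -/

section RealOfRational

/-- The rational form obtained by applying a linear functional to the coefficients of a real
form, as a linear function of the functional. -/
noncomputable def evalDual (M : Matrix (Fin 3) (Fin 3) ℝ) :
    Module.Dual ℚ ℝ →ₗ[ℚ] Matrix (Fin 3) (Fin 3) ℚ where
  toFun ψ := M.map ψ
  map_add' _ _ := rfl
  map_smul' _ _ := rfl

theorem evalDual_apply (M : Matrix (Fin 3) (Fin 3) ℝ) (ψ : Module.Dual ℚ ℝ) :
    evalDual M ψ = M.map ψ := rfl

theorem eq_zero_of_forall_evalDual {M : Matrix (Fin 3) (Fin 3) ℝ} (h : ∀ ψ, evalDual M ψ = 0) :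
    M = 0 := by
  ext i j
  exact (Module.forall_dual_apply_eq_zero_iff ℚ (M i j)).1 fun ψ => congrFun (congrFun (h ψ) i) j

theorem exists_dual_decomposition (s : Finset ℝ) :
    ∃ (n : ℕ) (t : Fin n → ℝ) (φ : Fin n → Module.Dual ℚ ℝ),
      ∀ x ∈ s, x = ∑ i, t i * φ i x := by
  classical
  let b := Module.Basis.ofVectorSpace ℚ ℝ
  let T := s.biUnion fun x => (b.repr x).support
  let e := T.equivFin
  refine ⟨T.card, fun i => b (e.symm i), fun i => b.coord (e.symm i), fun x hx => ?_⟩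
  rw [Equiv.sum_comp e.symm (fun i : T => b i * ((b.coord (i : _) x : ℚ) : ℝ)),
    Finset.sum_coe_sort T (fun i => b i * ((b.coord i x : ℚ) : ℝ))]
  conv_lhs => rw [← b.linearCombination_repr x, Finsupp.linearCombination_apply]
  refine (Finsupp.sum_of_support_subset (b.repr x) (Finset.subset_biUnion_of_mem
    (fun x => (b.repr x).support) hx) (fun i a => a • b i) (fun i _ => zero_smul _ _)).trans ?_
  exact Finset.sum_congr rfl fun i _ => by rw [Rat.smul_def, mul_comm, Module.Basis.coord_apply]

theorem exists_evalDual_decomposition (f g : Matrix (Fin 3) (Fin 3) ℝ) :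
    ∃ (n : ℕ) (t : Fin n → ℝ) (φ : Fin n → Module.Dual ℚ ℝ),
      f = ∑ i, t i • (evalDual f (φ i)).map ((↑) : ℚ → ℝ) ∧
      g = ∑ i, t i • (evalDual g (φ i)).map ((↑) : ℚ → ℝ) := by
  classical
  obtain ⟨n, t, φ, h⟩ := exists_dual_decomposition
    (Finset.univ.image (fun p : Fin 3 × Fin 3 => f p.1 p.2) ∪
      Finset.univ.image (fun p : Fin 3 × Fin 3 => g p.1 p.2))
  refine ⟨n, t, φ, ?_, ?_⟩
  · ext i j
    rw [h (f i j) (Finset.mem_union_left _ (Finset.mem_image.2 ⟨(i, j), Finset.mem_univ _, rfl⟩))]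
    simp [Matrix.sum_apply, evalDual_apply]
  · ext i j
    rw [h (g i j) (Finset.mem_union_right _ (Finset.mem_image.2 ⟨(i, j), Finset.mem_univ _, rfl⟩))]
    simp [Matrix.sum_apply, evalDual_apply]

theorem exists_posDef_evalDual {f : Matrix (Fin 3) (Fin 3) ℝ} (hf : f.PosDef) (sf : f.IsSymm) :
    ∃ φ : Module.Dual ℚ ℝ, ((evalDual f φ).map ((↑) : ℚ → ℝ)).PosDef := by
  obtain ⟨n, t, φ, h, -⟩ := exists_evalDual_decomposition f f
  have hs : ∀ q : Fin n → ℝ, (∑ i, q i • (evalDual f (φ i)).map ((↑) : ℚ → ℝ)).IsSymm := by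
    intro q
    rw [IsSymm, transpose_sum]
    exact Finset.sum_congr rfl fun i _ => (((sf.map (φ i)).map _).smul _)
  have hev := eventually_posDef
    (F := fun q : Fin n → ℝ => ∑ i, q i • (evalDual f (φ i)).map ((↑) : ℚ → ℝ)) (a := t)
    (fun i j => by
      simp only [Matrix.sum_apply, Matrix.smul_apply, smul_eq_mul]
      fun_prop) hs (h ▸ hf)
  have hdense : DenseRange (Pi.map fun (_ : Fin n) (q : ℚ) => (q : ℝ)) :=
    DenseRange.piMap fun _ => Rat.denseRange_cast
  obtain ⟨U, hU, hUo, htU⟩ := eventually_nhds_iff.1 hev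
  obtain ⟨q, hq⟩ := hdense.exists_mem_open hUo ⟨t, htU⟩
  refine ⟨∑ i, q i • φ i, ?_⟩
  convert hU _ hq using 1
  ext i j
  simp [Matrix.sum_apply, evalDual_apply]

theorem simRepZ_evalDual_eq {f g : Matrix (Fin 3) (Fin 3) ℝ} (h : repZR f = repZR g)
    (φ ψ : Module.Dual ℚ ℝ) :
    simRepZ (evalDual f φ) (evalDual f ψ) = simRepZ (evalDual g φ) (evalDual g ψ) := by
  simp only [evalDual_apply, simRepZ_map_dual, h]

theorem evalDual_eq_zero {f g : Matrix (Fin 3) (Fin 3) ℝ} (sg : g.IsSymm)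
    (h : repZR f = repZR g) {ψ : Module.Dual ℚ ℝ} (hψ : evalDual f ψ = 0) :
    evalDual g ψ = 0 := by
  refine eq_zero_of_forall_int (sg.map ψ) fun x hx => ?_
  have hmem : ((fun i => (x i : ℚ)) ⬝ᵥ (evalDual g ψ *ᵥ fun i => (x i : ℚ)),
      (fun i => (x i : ℚ)) ⬝ᵥ (evalDual g ψ *ᵥ fun i => (x i : ℚ))) ∈
      simRepZ (evalDual f ψ) (evalDual f ψ) := by
    rw [simRepZ_evalDual_eq h]
    exact ⟨x, hx, rfl, rfl⟩
  obtain ⟨y, -, hy, -⟩ := hmem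
  simpa [hψ] using hy.symm

theorem evalDual_independent {f g : Matrix (Fin 3) (Fin 3) ℝ} (sf : f.IsSymm)
    (h : repZR f = repZR g) {φ ψ : Module.Dual ℚ ℝ} (hφ : evalDual f φ ≠ 0)
    (hψ : evalDual f ψ ∉ Submodule.span ℚ {evalDual f φ}) (a b : ℚ)
    (hab : a • evalDual g φ + b • evalDual g ψ = 0) : a = 0 ∧ b = 0 := by
  rw [← map_smul, ← map_smul, ← map_add] at hab
  have hf := evalDual_eq_zero sf h.symm hab
  rw [map_add, map_smul, map_smul] at hf
  have hb : b = 0 := by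
    by_contra hb
    refine hψ (Submodule.mem_span_singleton.2 ⟨-(b⁻¹ * a), ?_⟩)
    have : b⁻¹ • (a • evalDual f φ + b • evalDual f ψ) = 0 := by rw [hf, smul_zero]
    rw [smul_add, smul_smul, smul_smul, inv_mul_cancel₀ hb, one_smul] at this
    rw [neg_smul]
    exact neg_eq_of_add_eq_zero_right this
  rw [hb, zero_smul, add_zero] at hf
  exact ⟨(smul_eq_zero.1 hf).resolve_right hφ, hb⟩

/-- Isometries of the pencils which all contain a fixed positive definite form can be chosen
uniformly, hence come from an isometry of the real forms. -/
theorem equivZR_of_forall_evalDual {f g : Matrix (Fin 3) (Fin 3) ℝ} {φ : Module.Dual ℚ ℝ}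
    (hg : ((evalDual g φ).map ((↑) : ℚ → ℝ)).PosDef)
    {p : Submodule ℚ (Matrix (Fin 3) (Fin 3) ℚ)} (hp : ∃ ψ, evalDual f ψ ∉ p)
    (h : ∀ ψ, evalDual f ψ ∉ p → ∃ w : Matrix (Fin 3) (Fin 3) ℤ, IsUnit w.det ∧
      evalDual f φ = conj w (evalDual g φ) ∧ evalDual f ψ = conj w (evalDual g ψ)) :
    equivZR g f := by
  let I := {w : Matrix (Fin 3) (Fin 3) ℤ | IsUnit w.det ∧
    evalDual f φ = conj w (evalDual g φ)}
  have hI : I.Finite := by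
    refine (finite_setOf_conj_eq ((evalDual f φ).map ((↑) : ℚ → ℝ)) hg).subset ?_
    rintro w ⟨-, hw⟩
    have : conj w ((evalDual g φ).map ((↑) : ℚ → ℝ)) = (evalDual f φ).map ((↑) : ℚ → ℝ) := by
      rw [conj_map_ratCast, hw]
    exact this
  have : Finite I := hI
  let E : Option I → Submodule ℚ (Module.Dual ℚ ℝ) := fun o =>
    o.elim (p.comap (evalDual f)) fun w => LinearMap.ker (evalDual (f - conj w.1 g))
  have hker : ∀ (w : Matrix (Fin 3) (Fin 3) ℤ) (ψ : Module.Dual ℚ ℝ),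
      evalDual (f - conj w g) ψ = evalDual f ψ - conj w (evalDual g ψ) := by
    intro w ψ
    rw [evalDual_apply g, ← conj_map_dual]
    ext i j
    simp [evalDual_apply]
  have hcover : ⋃ o, (E o : Set (Module.Dual ℚ ℝ)) = Set.univ := by
    refine Set.eq_univ_of_forall fun ψ => Set.mem_iUnion.2 ?_
    by_cases hψ : evalDual f ψ ∈ p
    · exact ⟨none, hψ⟩
    · obtain ⟨w, hw, h1, h2⟩ := h ψ hψ
      refine ⟨some ⟨w, hw, h1⟩, ?_⟩
      change evalDual (f - conj w g) ψ = 0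
      rw [hker, h2, sub_self]
  obtain ⟨o, ho⟩ := Subspace.exists_eq_top_of_iUnion_eq_univ hcover
  cases o with
  | none =>
    obtain ⟨ψ, hψ⟩ := hp
    have : ψ ∈ E none := ho ▸ Submodule.mem_top
    exact absurd this hψ
  | some w =>
    refine ⟨w.1, w.2.1, ?_⟩
    have : f - conj w.1 g = 0 := eq_zero_of_forall_evalDual fun ψ => by
      have : ψ ∈ E (some w) := ho ▸ Submodule.mem_top
      exact this
    exact (sub_eq_zero.1 this).symm

theorem exists_coeff_of_forall_evalDual {f g : Matrix (Fin 3) (Fin 3) ℝ} (sg : g.IsSymm)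
    (h : repZR f = repZR g) {φ χ : Module.Dual ℚ ℝ}
    (hspan : ∀ ψ, ∃ a b : ℚ, evalDual f ψ = a • evalDual f φ + b • evalDual f χ) :
    ∃ σ τ : ℝ,
      f = σ • (evalDual f φ).map ((↑) : ℚ → ℝ) + τ • (evalDual f χ).map ((↑) : ℚ → ℝ) ∧
      g = σ • (evalDual g φ).map ((↑) : ℚ → ℝ) + τ • (evalDual g χ).map ((↑) : ℚ → ℝ) := by
  obtain ⟨n, t, θ, hf, hg⟩ := exists_evalDual_decomposition f g
  choose a b hab using hspan
  have hab' : ∀ ψ, evalDual g ψ = a ψ • evalDual g φ + b ψ • evalDual g χ := fun ψ => by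
    have h1 : evalDual f (ψ - (a ψ • φ + b ψ • χ)) = 0 := by
      rw [map_sub, map_add, map_smul, map_smul, ← hab, sub_self]
    have h2 := evalDual_eq_zero sg h h1
    rwa [map_sub, map_add, map_smul, map_smul, sub_eq_zero] at h2
  refine ⟨∑ i, t i * a (θ i), ∑ i, t i * b (θ i), ?_, ?_⟩
  · conv_lhs => rw [hf]
    simp only [Finset.sum_smul, ← Finset.sum_add_distrib]
    refine Finset.sum_congr rfl fun i _ => ?_
    conv_lhs => rw [hab (θ i)]
    ext j k
    simp
    ring
  · conv_lhs => rw [hg]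
    simp only [Finset.sum_smul, ← Finset.sum_add_distrib]
    refine Finset.sum_congr rfl fun i _ => ?_
    conv_lhs => rw [hab' (θ i)]
    ext j k
    simp
    ring

theorem equivZR_combination {P Q H Z : Matrix (Fin 3) (Fin 3) ℚ}
    {w : Matrix (Fin 3) (Fin 3) ℤ} (hw : IsUnit w.det) {v : Matrix (Fin 2) (Fin 2) ℚ}
    (h : (P, Q) = pairAct (w.map ((↑) : ℤ → ℚ)) v H Z) (σ τ : ℝ) :
    equivZR (σ • P.map ((↑) : ℚ → ℝ) + τ • Q.map ((↑) : ℚ → ℝ))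
      ((σ * v 0 0 + τ * v 1 0) • H.map ((↑) : ℚ → ℝ) +
        (σ * v 0 1 + τ * v 1 1) • Z.map ((↑) : ℚ → ℝ)) := by
  rw [pairAct_map, Prod.mk.injEq] at h
  refine equivZR_symm ⟨w, hw, ?_⟩
  change conj w _ = _
  rw [h.1, h.2, ← conj_map_ratCast, ← conj_map_ratCast, ← conj_smul, ← conj_smul, ← conj_add]
  congr 1
  ext i j
  simp
  ring

theorem rkStatement_of_starStatement (hstar : StarStatement) : RKStatement := by
  intro f g sf sg hf hg hirr hrep hne
  obtain ⟨φ, hφ⟩ := exists_posDef_evalDual hf sf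
  have hφg : ((evalDual g φ).map ((↑) : ℚ → ℝ)).PosDef := by
    have := posDef_of_simRepZ_eq (c := 1) (d := 0) (sg.map φ) (sg.map φ)
      (simRepZ_evalDual_eq hrep φ φ) (by simpa using hφ)
    simpa [evalDual_apply] using this
  have hdet : (evalDual f φ).det ≠ 0 := by
    intro h0
    have h1 : ((evalDual f φ).map ((↑) : ℚ → ℝ)).det = ((evalDual f φ).det : ℝ) :=
      ((Rat.castHom ℝ).map_det _).symm
    exact hφ.det_pos.ne' (by rw [h1, h0, Rat.cast_zero])
  have hφ0 : evalDual f φ ≠ 0 := fun h0 => hdet (by rw [h0, det_zero])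
  have hPos : ∀ x : Fin 3 → ℚ, x ≠ 0 → 0 < x ⬝ᵥ (evalDual f φ *ᵥ x) := by
    intro x hx
    have hx' : (fun i => (x i : ℝ)) ≠ 0 := fun h0 => hx (funext fun i => by
      simpa using congrFun h0 i)
    have := hφ.dotProduct_mulVec_pos hx'
    rw [star_trivial, ← cast_dotProduct_mulVec] at this
    exact_mod_cast this
  have hsplit : ∀ ψ, evalDual f ψ ∉ Submodule.span ℚ {evalDual f φ} →
      (∃ w : Matrix (Fin 3) (Fin 3) ℤ, IsUnit w.det ∧
        evalDual f φ = conj w (evalDual g φ) ∧ evalDual f ψ = conj w (evalDual g ψ)) ∨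
      IsExceptional (evalDual f φ) (evalDual f ψ) (evalDual g φ) (evalDual g ψ) := by
    intro ψ hψ
    have := hstar (evalDual f φ) (evalDual f ψ) (evalDual g φ) (evalDual g ψ)
      (sf.map φ) (sf.map ψ) (sg.map φ) (sg.map ψ) (evalDual_independent sf rfl hφ0 hψ)
      (evalDual_independent sf hrep hφ0 hψ)
      ⟨1, 0, by simpa using hφ⟩ ⟨1, 0, by simpa using hφg⟩ (simRepZ_evalDual_eq hrep φ ψ)
    rw [← isExceptional_iff] at this
    refine this.imp_left ?_
    rintro ⟨w, hw, h⟩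
    rw [pairAct_map, Prod.mk.injEq] at h
    exact ⟨w, hw, by simpa using h.1, by simpa using h.2⟩
  have hex : ∃ ψ, evalDual f ψ ∉ Submodule.span ℚ {evalDual f φ} := by
    by_contra! hall
    obtain ⟨σ, τ, h, -⟩ := exists_coeff_of_forall_evalDual (φ := φ) (χ := φ) sf rfl fun ψ => by
      obtain ⟨a, ha⟩ := Submodule.mem_span_singleton.1 (hall ψ)
      exact ⟨a, 0, by simp [ha]⟩
    rw [← add_smul] at h
    have hne0 : σ + τ ≠ 0 := by
      intro h0
      rw [h0, zero_smul] at h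
      have := hf.diag_pos (i := 0)
      simp [h] at this
    obtain ⟨i, j, hij⟩ := hirr (σ + τ)⁻¹ (inv_ne_zero hne0)
    refine hij (evalDual f φ i j) ?_
    conv_lhs => rw [h]
    simp [hne0]
  obtain ⟨χ, hχ, hexc⟩ : ∃ χ, evalDual f χ ∉ Submodule.span ℚ {evalDual f φ} ∧
      IsExceptional (evalDual f φ) (evalDual f χ) (evalDual g φ) (evalDual g χ) := by
    by_contra! hnone
    exact hne (equivZR_symm (equivZR_of_forall_evalDual hφg hex fun ψ hψ =>
      (hsplit ψ hψ).resolve_right (hnone ψ hψ)))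
  have hspan : ∀ ψ, ∃ a b : ℚ, evalDual f ψ = a • evalDual f φ + b • evalDual f χ := by
    intro ψ
    refine mem_span_pair_of_rank_one hPos (W := LinearMap.range (evalDual f)) ⟨φ, rfl⟩ ?_
      ⟨χ, rfl⟩ hχ ⟨ψ, rfl⟩
    rintro _ ⟨θ, rfl⟩ hθ
    rcases hsplit θ hθ with ⟨w, hw, h1, -⟩ | h
    · exact absurd (by rw [h1, det_conj hw]) (hexc.det_ne hdet)
    · exact h.exists_eq_add_vecMulVec hdet
  obtain ⟨σ, τ, h1, h2⟩ := exists_coeff_of_forall_evalDual sg hrep hspan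
  obtain ⟨w₁, w₂, u₁, u₂, v, -, H, Z, H', Z', hm, e₁, e₂⟩ := hexc
  refine ⟨σ * v 0 0 + τ * v 1 0, σ * v 0 1 + τ * v 1 1,
    (exists_isModel_iff f g _ _).1 ⟨H, Z, H', Z', hm, ?_, ?_⟩⟩
  · rw [h1]
    exact equivZR_combination u₁ e₁ σ τ
  · rw [h2]
    exact equivZR_combination u₂ e₂ σ τ

end RealOfRational

end TernaryPair

theorem stmt_18 : RKStatement ↔ StarStatement := by
  exact ⟨TernaryPair.starStatement_of_rkStatement, TernaryPair.rkStatement_of_starStatement⟩
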